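/- If m, n ≥ 4 with m and n both even, then dmg(C_m □ C_n) ≤ 1 + max{ dmg(C_m)·|V(C_n)| , dmg(C_n)·|V(C_m)| }. -/

import Mathlib

open SimpleGraph

/-!
Formalization of the game of Cops and Robber (one cop, one robber) and the damage number.

Round 0: the cop chooses a starting vertex, then the robber chooses a starting vertex.
In each subsequent round the cop moves to an adjacent vertex or passes, after which the
robber moves to an adjacent vertex or passes.  Strategies are modelled as functions of
the full history of positions (most recent first).
-/

/-- A cop strategy: an initial vertex together with a move function taking the history of
cop positions (most recent first, nonempty) and of robber positions (most recent first)
to the cop's next position. -/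
structure CopStrategy (V : Type*) where
  init : V
  move : List V → List V → V

/-- A robber strategy: an initial vertex chosen in response to the cop's initial vertex,
together with a move function taking the history of cop positions (most recent first,
including the cop's move from the current round) and of robber positions (most recent
first) to the robber's next position. -/
structure RobberStrategy (V : Type*) where
  init : V → V
  move : List V → List V → V

variable {V : Type*}

/-- A cop move function is legal for `G` if from any position it either passes or
moves along an edge of `G`. -/
def LegalCopMove (G : SimpleGraph V) (cs : List V → List V → V) : Prop :=
  ∀ (c : V) (ch rh : List V), cs (c :: ch) rh = c ∨ G.Adj c (cs (c :: ch) rh)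

/-- A robber move function is legal for `G` if from any position it either passes or
moves along an edge of `G`. -/
def LegalRobMove (G : SimpleGraph V) (rs : List V → List V → V) : Prop :=
  ∀ (r : V) (ch rh : List V), rs ch (r :: rh) = r ∨ G.Adj r (rs ch (r :: rh))

/-- A legal cop strategy: every move passes or goes along an edge. -/
def CopStrategy.Legal (G : SimpleGraph V) (CS : CopStrategy V) : Prop :=
  LegalCopMove G CS.move

/-- A legal robber strategy: every move passes or goes along an edge. -/
def RobberStrategy.Legal (G : SimpleGraph V) (RS : RobberStrategy V) : Prop :=
  LegalRobMove G RS.move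

/-- `play CS RS n = (cₙ, rₙ, earlier cop positions, earlier robber positions)`:
the state of the game after round `n`, when the cop plays `CS` and the robber plays `RS`.
In each round the cop moves first, then the robber moves. -/
def play (CS : CopStrategy V) (RS : RobberStrategy V) : ℕ → V × V × List V × List V
  | 0 => (CS.init, RS.init CS.init, [], [])
  | n + 1 =>
    let p := play CS RS n
    let c := CS.move (p.1 :: p.2.2.1) (p.2.1 :: p.2.2.2)
    let r := RS.move (c :: p.1 :: p.2.2.1) (p.2.1 :: p.2.2.2)
    (c, r, p.1 :: p.2.2.1, p.2.1 :: p.2.2.2)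

/-- The cop's position after its move in round `n`. -/
def copPos (CS : CopStrategy V) (RS : RobberStrategy V) (n : ℕ) : V := (play CS RS n).1

/-- The robber's position after its move in round `n`. -/
def robPos (CS : CopStrategy V) (RS : RobberStrategy V) (n : ℕ) : V := (play CS RS n).2.1

/-- The robber damages `v`: at the end of some round `n` the robber occupies `v`, having
never been captured up to that point (neither by moving onto the cop, nor by the cop's
move in any round up to and including round `n + 1`); it then passes or moves in
round `n + 1`, damaging `v`. -/
def Damages (CS : CopStrategy V) (RS : RobberStrategy V) (v : V) : Prop :=
  ∃ n, robPos CS RS n = v ∧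
    ∀ k ≤ n, copPos CS RS k ≠ robPos CS RS k ∧ copPos CS RS (k + 1) ≠ robPos CS RS k

/-- The set of vertices damaged by the robber during the play of `CS` against `RS`. -/
def damageSet (CS : CopStrategy V) (RS : RobberStrategy V) : Set V :=
  {v | Damages CS RS v}

/-- The damage number of `G`: the minimum over legal cop strategies of the maximum over
legal robber strategies of the number of distinct damaged vertices. -/
noncomputable def dmg (G : SimpleGraph V) : ℕ :=
  sInf { n | ∃ CS : CopStrategy V, CS.Legal G ∧
    ∀ RS : RobberStrategy V, RS.Legal G → (damageSet CS RS).ncard ≤ n }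

/-- A cop strategy passes during the first round. -/
def CopStrategy.PassesFirst (CS : CopStrategy V) : Prop :=
  ∀ r : V, CS.move [CS.init] [r] = CS.init

/-- The damage number of `G` when the cop is required to pass during the first round. -/
noncomputable def dmg' (G : SimpleGraph V) : ℕ :=
  sInf { n | ∃ CS : CopStrategy V, CS.Legal G ∧ CS.PassesFirst ∧
    ∀ RS : RobberStrategy V, RS.Legal G → (damageSet CS RS).ncard ≤ n }

/-- The eccentricity of a vertex: the maximum distance from `u` to any vertex. -/
noncomputable def ecc (G : SimpleGraph V) (u : V) : ℕ := sSup (Set.range (G.dist u))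

/-- The radius of a graph: the minimum eccentricity over all vertices. -/
noncomputable def gRadius (G : SimpleGraph V) : ℕ := sInf (Set.range (ecc G))


/-- If the cop can maintain `P cop robber damaged` (after each cop move), and `P` bounds the
damage, then the damage number is bounded. -/
theorem dmg_le_of_invariant {V : Type*} [Finite V] (G : SimpleGraph V) (N : ℕ)
    (P : V → V → Set V → Prop) (c0 : V)
    (hcard : ∀ c r D, P c r D → D.ncard ≤ N)
    (hinit : ∀ r, ∃ c, (c = c0 ∨ G.Adj c0 c) ∧ (c = r ∨ P c r {r}))
    (hstep : ∀ c r D, P c r D → ∀ r', (r' = r ∨ G.Adj r r') →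
      ∃ c', (c' = c ∨ G.Adj c c') ∧ (c' = r' ∨ P c' r' (insert r' D))) :
    dmg G ≤ N := by
  classical
  let Good : V → V → Set V → V → Prop := fun c r D c' =>
    (c' = c ∨ G.Adj c c') ∧ (c' = r ∨ P c' r D)
  let mv : List V → List V → V := fun cl rl =>
    match cl, rl with
    | c :: _, r :: rh =>
      if h : ∃ c', Good c r {x | x ∈ r :: rh} c' then h.choose else c
    | c :: _, [] => c
    | [], _ => c0
  let CS : CopStrategy V := ⟨c0, mv⟩
  have hmv : ∀ c ch r rh, (∃ c', Good c r {x | x ∈ r :: rh} c') →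
      Good c r {x | x ∈ r :: rh} (mv (c :: ch) (r :: rh)) := by
    intro c ch r rh h
    have : mv (c :: ch) (r :: rh) = h.choose := by
      simp only [mv]; rw [dif_pos h]
    rw [this]; exact h.choose_spec
  have hlegal : CS.Legal G := by
    intro c ch rh
    cases rh with
    | nil => left; rfl
    | cons r rh =>
      by_cases h : ∃ c', Good c r {x | x ∈ r :: rh} c'
      · exact (hmv c ch r rh h).1
      · left
        change mv (c :: ch) (r :: rh) = c
        simp only [mv]; rw [dif_neg h]
  apply Nat.sInf_le
  refine ⟨CS, hlegal, fun RS hRS => ?_⟩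
  let D : ℕ → Set V := fun n => {x | x ∈ (play CS RS n).2.1 :: (play CS RS n).2.2.2}
  have hDsucc : ∀ n, D (n+1) = insert (robPos CS RS (n+1)) (D n) := by
    intro n; ext x; simp [D, play, robPos]
  have hDmem : ∀ n, robPos CS RS n ∈ D n := by
    intro n; simp [D, robPos]
  have hDmono : Monotone D := by
    apply monotone_nat_of_le_succ
    intro n; rw [hDsucc]; exact Set.subset_insert _ _
  have hrob : ∀ n, robPos CS RS (n+1) = robPos CS RS n ∨
      G.Adj (robPos CS RS n) (robPos CS RS (n+1)) := by
    intro n; exact hRS _ _ _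
  have hcop : ∀ n, (∃ c', Good (copPos CS RS n) (robPos CS RS n) (D n) c') →
      Good (copPos CS RS n) (robPos CS RS n) (D n) (copPos CS RS (n+1)) := by
    intro n h; exact hmv _ (play CS RS n).2.2.1 _ (play CS RS n).2.2.2 h
  have key : ∀ n, (∀ k ≤ n, copPos CS RS k ≠ robPos CS RS k ∧
      copPos CS RS (k + 1) ≠ robPos CS RS k) →
      P (copPos CS RS (n+1)) (robPos CS RS n) (D n) := by
    intro n
    induction n with
    | zero =>
      intro h
      have hD0 : D 0 = {robPos CS RS 0} := by
        ext x; simp [D, play, robPos]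
      have h0 := hcop 0 (by rw [hD0]; exact hinit _)
      exact h0.2.resolve_left (h 0 le_rfl).2
    | succ n ih =>
      intro h
      have hP := ih (fun k hk => h k (by omega))
      have h1 := hcop (n+1) (by rw [hDsucc]; exact hstep _ _ _ hP _ (hrob n))
      exact h1.2.resolve_left (h (n+1) le_rfl).2
  have hfin : (damageSet CS RS).Finite := Set.toFinite _
  by_cases hne : (damageSet CS RS).Nonempty
  · have hw : ∀ v : V, ∃ n, v ∈ damageSet CS RS → (robPos CS RS n = v ∧
      ∀ k ≤ n, copPos CS RS k ≠ robPos CS RS k ∧ copPos CS RS (k + 1) ≠ robPos CS RS k) := by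
      intro v
      by_cases hv : v ∈ damageSet CS RS
      · obtain ⟨n, hn⟩ := hv
        exact ⟨n, fun _ => hn⟩
      · exact ⟨0, fun h => absurd h hv⟩
    choose f hf using hw
    obtain ⟨w, hw, hmax⟩ := Set.exists_max_image _ f hfin hne
    have hsub : damageSet CS RS ⊆ D (f w) := by
      intro v hv
      have := hDmem (f v)
      rw [(hf v hv).1] at this
      exact hDmono (hmax v hv) this
    exact (Set.ncard_le_ncard hsub (Set.toFinite _)).trans (hcard _ _ _ (key _ (hf w hw).2))
  · rw [Set.not_nonempty_iff_eq_empty] at hne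
    simp [hne]

/-- The covering map from the integers to the cycle. -/
def cyc (m : ℕ) [NeZero m] (k : ℤ) : Fin m :=
  ⟨(k % m).toNat, by
    have : (m : ℤ) ≠ 0 := by exact_mod_cast NeZero.ne m
    have h1 := Int.emod_nonneg k this
    have h2 := Int.emod_lt_of_pos k (show (0 : ℤ) < m by omega)
    omega⟩

theorem cyc_val (m : ℕ) [NeZero m] (k : ℤ) : ((cyc m k).val : ℤ) = k % m := by
  have : (m : ℤ) ≠ 0 := by exact_mod_cast NeZero.ne m
  have h1 := Int.emod_nonneg k this
  simp only [cyc]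
  omega

theorem cyc_eq_iff (m : ℕ) [NeZero m] (j k : ℤ) : cyc m j = cyc m k ↔ (m : ℤ) ∣ j - k := by
  rw [Fin.ext_iff, ← Int.ofNat_inj, cyc_val, cyc_val, Int.emod_eq_emod_iff_emod_sub_eq_zero,
    Int.dvd_iff_emod_eq_zero]

theorem cyc_self (m : ℕ) [NeZero m] (v : Fin m) : cyc m (v.val : ℤ) = v := by
  rw [Fin.ext_iff, ← Int.ofNat_inj, cyc_val]
  exact Int.emod_eq_of_lt (by omega) (by have := v.isLt; omega)

theorem cyc_congr (m : ℕ) [NeZero m] {j k : ℤ} (q : ℤ) (h : j - k = m * q) :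
    cyc m j = cyc m k := by
  rw [cyc_eq_iff, h]; exact dvd_mul_right _ _

theorem cyc_adj (m : ℕ) [NeZero m] (hm : 4 ≤ m) (j k : ℤ) :
    (cycleGraph m).Adj (cyc m j) (cyc m k) ↔ (m : ℤ) ∣ j - k - 1 ∨ (m : ℤ) ∣ k - j - 1 := by
  have aux : ∀ j k : ℤ, ((cyc m j - cyc m k).val = 1 ↔ (m : ℤ) ∣ j - k - 1) := by
    intro j k
    have hj := cyc_val m j
    have hk := cyc_val m k
    have h1 : (((cyc m j - cyc m k).val : ℕ) : ℤ) = (j - k) % m := by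
      rw [Fin.sub_def]
      push_cast
      rw [Nat.cast_sub (cyc m k).isLt.le, hj, hk]
      rw [show ((m : ℤ) - k % m + j % m) = (j % m - k % m) + m by ring]
      rw [Int.add_emod_right, ← Int.sub_emod]
    rw [← Int.ofNat_inj, h1, Int.dvd_iff_emod_eq_zero, ← Int.emod_eq_emod_iff_emod_sub_eq_zero]
    rw [Int.emod_eq_of_lt (a := 1) (by omega) (by omega)]
    simp
  rw [cycleGraph_adj', aux, aux]

theorem cyc_adj_succ (m : ℕ) [NeZero m] (hm : 4 ≤ m) {j k : ℤ} (h : k = j + 1 ∨ k = j - 1) :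
    (cycleGraph m).Adj (cyc m j) (cyc m k) := by
  rw [cyc_adj m hm]
  rcases h with rfl | rfl
  · right; simp
  · left; simp

theorem cyc_adj_elim (m : ℕ) [NeZero m] (hm : 4 ≤ m) {j : ℤ} {v : Fin m}
    (h : (cycleGraph m).Adj (cyc m j) v) : v = cyc m (j+1) ∨ v = cyc m (j-1) := by
  rw [← cyc_self m v, cyc_adj m hm] at h
  rw [← cyc_self m v, cyc_eq_iff, cyc_eq_iff]
  rcases h with h | h
  · right
    have h' := (dvd_neg).2 h
    rwa [show -(j - (v.val : ℤ) - 1) = (v.val : ℤ) - (j - 1) by ring] at h'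
  · left
    rwa [show (v.val : ℤ) - j - 1 = (v.val : ℤ) - (j + 1) by ring] at h

theorem cyc_surj (m : ℕ) [NeZero m] (a : ℕ) (ha : m = 2 * a) (v : Fin m) :
    ∃ k : ℤ, v = cyc m k ∧ -(a : ℤ) ≤ k ∧ k ≤ a := by
  by_cases h : v.val ≤ a
  · exact ⟨v.val, (cyc_self m v).symm, by omega, by omega⟩
  · refine ⟨v.val - m, ?_, ?_, ?_⟩
    · rw [cyc_congr m (j := (v.val : ℤ) - m) (k := v.val) (-1) (by ring), cyc_self]
    · omega
    · have := v.isLt; omega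

/-- The lower bound for cycles: the robber starts at distance two and runs away. -/
theorem dmg_cycle_lower (m a : ℕ) (hm : 4 ≤ m) (ha : m = 2 * a) :
    a - 1 ≤ dmg (cycleGraph m) := by
  haveI : NeZero m := ⟨by omega⟩
  have hne : { n | ∃ CS : CopStrategy (Fin m), CS.Legal (cycleGraph m) ∧
    ∀ RS : RobberStrategy (Fin m), RS.Legal (cycleGraph m) →
      (damageSet CS RS).ncard ≤ n }.Nonempty := by
    refine ⟨Nat.card (Fin m), ⟨cyc m 0, fun cl _ => cl.headD (cyc m 0)⟩, ?_, ?_⟩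
    · intro c ch rh; left; rfl
    · intro RS _; exact Set.ncard_le_card _
  obtain ⟨CS, hCS, hdmg⟩ := Nat.sInf_mem hne
  change ∀ RS : RobberStrategy (Fin m), RS.Legal (cycleGraph m) →
      (damageSet CS RS).ncard ≤ dmg (cycleGraph m) at hdmg
  let RS : RobberStrategy (Fin m) :=
    ⟨fun c => cyc m (c.val - 2), fun _ rl => cyc m ((rl.headD (cyc m 0)).val - 1)⟩
  have hRS : RS.Legal (cycleGraph m) := by
    intro r ch rh
    right
    change (cycleGraph m).Adj r (cyc m (r.val - 1))
    conv_lhs => rw [← cyc_self m r]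
    exact cyc_adj_succ m hm (Or.inr rfl)
  refine le_trans ?_ (hdmg RS hRS)
  have hrob : ∀ t : ℕ, robPos CS RS t = cyc m (CS.init.val - 2 - t) := by
    intro t
    induction t with
    | zero => simp [robPos, play, RS]
    | succ t ih =>
      have : robPos CS RS (t+1) = cyc m ((robPos CS RS t).val - 1) := rfl
      rw [this, ih, cyc_eq_iff, cyc_val, Int.emod_def]
      refine ⟨-((CS.init.val - 2 - t : ℤ) / m), ?_⟩
      push_cast; ring
  have hcop : ∀ t : ℕ, ∃ s : ℤ, -t ≤ s ∧ s ≤ t ∧ copPos CS RS t = cyc m (CS.init.val + s) := by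
    intro t
    induction t with
    | zero => exact ⟨0, by simp, by simp, by simp [copPos, play, cyc_self]⟩
    | succ t ih =>
      obtain ⟨s, h1, h2, h3⟩ := ih
      have hl : copPos CS RS (t+1) = copPos CS RS t ∨
        (cycleGraph m).Adj (copPos CS RS t) (copPos CS RS (t+1)) := hCS _ _ _
      rcases hl with hl | hl
      · exact ⟨s, by push_cast; omega, by push_cast; omega, by rw [hl, h3]⟩
      · rw [h3] at hl
        rcases cyc_adj_elim m hm hl with h | h
        · exact ⟨s + 1, by push_cast; omega, by push_cast; omega, by rw [h]; congr 1; ring⟩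
        · exact ⟨s - 1, by push_cast; omega, by push_cast; omega, by rw [h]; congr 1; ring⟩
  have hsafe : ∀ x : ℤ, 0 < x → x < m → ¬ (m : ℤ) ∣ x := by
    intro x h1 h2 h3
    have := Int.le_of_dvd h1 h3
    omega
  have hsub : ((Finset.range (a-1)).image (fun t : ℕ => cyc m (CS.init.val - 2 - t)) :
      Set (Fin m)) ⊆ damageSet CS RS := by
    intro v hv
    simp only [Finset.coe_image, Set.mem_image, Finset.coe_range, Set.mem_Iio] at hv
    obtain ⟨t, ht, rfl⟩ := hv
    refine ⟨t, hrob t, fun k hk => ?_⟩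
    rw [hrob k]
    constructor
    · obtain ⟨s, h1, h2, h3⟩ := hcop k
      rw [h3, Ne, cyc_eq_iff]
      apply hsafe <;> omega
    · obtain ⟨s, h1, h2, h3⟩ := hcop (k+1)
      rw [h3, Ne, cyc_eq_iff]
      push_cast at h1 h2
      apply hsafe <;> omega
  have hc := Set.ncard_le_ncard hsub (Set.toFinite _)
  rw [Set.ncard_coe_finset, Finset.card_image_of_injOn, Finset.card_range] at hc
  · exact hc
  · intro i hi j hj hij
    simp only [Finset.coe_range, Set.mem_Iio] at hi hj
    simp only [cyc_eq_iff] at hij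
    by_contra hne
    rcases lt_or_gt_of_ne hne with h | h
    · exact hsafe _ (by omega) (by omega) hij
    · exact hsafe _ (by omega) (by omega) ((dvd_neg).2 hij)

/-- Main phase invariant. The robber is `(X, Y)` ahead of the cop, and apart from `e` all damage
lies in the columns from `l` to the left to `h` to the right of the robber. -/
def Qinv (m n : ℕ) [NeZero m] [NeZero n] (e c r : Fin m × Fin n) (D : Set (Fin m × Fin n)) : Prop :=
  ∃ x y X Y l h : ℤ, c = (cyc m x, cyc n y) ∧ r = (cyc m (x + X), cyc n (y + Y)) ∧
    0 ≤ l ∧ 0 ≤ h ∧ 2 * l + |Y| < X ∧ 2 * h + |Y| < m - X ∧ (2 : ℤ) ∣ X + Y ∧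
    ∀ v ∈ D, v = e ∨ ∃ t, -l ≤ t ∧ t ≤ h ∧ v.1 = cyc m (x + X + t)

theorem Qinv_card (m n a : ℕ) [NeZero m] [NeZero n] (ha : m = 2 * a)
    (e c r : Fin m × Fin n) (D : Set (Fin m × Fin n)) (hQ : Qinv m n e c r D) :
    D.ncard ≤ 1 + (a - 1) * n := by
  obtain ⟨x, y, X, Y, l, h, -, -, hl, hh, h1, h2, h3, h4⟩ := hQ
  let C : Finset (Fin m) := (Finset.Icc (-l) h).image (fun t => cyc m (x + X + t))
  have hsub : D ⊆ (insert e (C ×ˢ (Finset.univ : Finset (Fin n))) : Finset (Fin m × Fin n)) := by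
    intro v hv
    rcases h4 v hv with rfl | ⟨t, ht1, ht2, ht3⟩
    · simp
    · simp only [Finset.coe_insert, Set.mem_insert_iff, Finset.mem_coe, Finset.mem_product,
        Finset.mem_univ, and_true]
      right
      exact Finset.mem_image.2 ⟨t, Finset.mem_Icc.2 ⟨ht1, ht2⟩, ht3.symm⟩
  have hc := Set.ncard_le_ncard hsub (Set.toFinite _)
  rw [Set.ncard_coe_finset] at hc
  have hC : C.card ≤ a - 1 := by
    refine Finset.card_image_le.trans ?_
    rw [Int.card_Icc]
    rcases abs_cases Y with ⟨h5, h6⟩ | ⟨h5, h6⟩ <;> rw [h5] at h1 h2 <;> omega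
  refine hc.trans ((Finset.card_insert_le _ _).trans ?_)
  rw [Finset.card_product, Finset.card_univ, Fintype.card_fin]
  have := Nat.mul_le_mul_right n hC
  omega

theorem Qinv_step (m n a : ℕ) [NeZero m] [NeZero n] (hm : 4 ≤ m) (hn : 4 ≤ n) (ha : m = 2 * a)
    (e c r : Fin m × Fin n) (D : Set (Fin m × Fin n)) (hQ : Qinv m n e c r D)
    (r' : Fin m × Fin n) (hr : r' = r ∨ (cycleGraph m □ cycleGraph n).Adj r r') :
    ∃ c', (c' = c ∨ (cycleGraph m □ cycleGraph n).Adj c c') ∧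
      (c' = r' ∨ Qinv m n e c' r' (insert r' D)) := by
  obtain ⟨x, y, X, Y, l, h, rfl, rfl, hl, hh, h1, h2, h3, h4⟩ := hQ
  rcases hr with rfl | hr
  · refine ⟨_, Or.inl rfl, Or.inr ⟨x, y, X, Y, l, h, rfl, rfl, hl, hh, h1, h2, h3, ?_⟩⟩
    intro v hv
    rcases hv with rfl | hv
    · exact Or.inr ⟨0, by omega, by omega, by simp⟩
    · exact h4 v hv
  obtain ⟨u, w⟩ := r'
  rw [boxProd_adj] at hr
  rcases hr with ⟨hr, rfl⟩ | ⟨hr, rfl⟩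
  · -- horizontal move by `d`
    have hd : ∃ d : ℤ, (d = 1 ∨ d = -1) ∧ u = cyc m (x + X + d) := by
      rcases cyc_adj_elim m hm hr with hu | hu
      · exact ⟨1, Or.inl rfl, hu⟩
      · exact ⟨-1, Or.inr rfl, hu⟩
    obtain ⟨d, hd, rfl⟩ := hd
    have hD : ∀ x' X' l' h' : ℤ, x' + X' = x + X + d → 0 ≤ l' → 0 ≤ h' → l + d ≤ l' →
        h - d ≤ h' →
        ∀ v ∈ insert (cyc m (x + X + d), cyc n (y + Y)) D,
          v = e ∨ ∃ t, -l' ≤ t ∧ t ≤ h' ∧ v.1 = cyc m (x' + X' + t) := by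
      intro x' X' l' h' e1 e2 e3 e4 e5 v hv
      rcases hv with rfl | hv
      · exact Or.inr ⟨0, by omega, by omega, by simp [e1]⟩
      · rcases h4 v hv with hv | ⟨t, t1, t2, t3⟩
        · exact Or.inl hv
        · exact Or.inr ⟨t - d, by omega, by omega, by rw [t3, e1]; congr 1; ring⟩
    by_cases hY : Y = 0
    · subst hY
      simp only [abs_zero] at h1 h2
      by_cases hcap : X + d = 1 ∨ X + d = m - 1
      · refine ⟨_, Or.inr ?_, Or.inl rfl⟩
        rw [boxProd_adj]
        left
        refine ⟨?_, by simp⟩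
        rcases hcap with hcap | hcap
        · exact cyc_adj_succ m hm (Or.inl (by omega))
        · change (cycleGraph m).Adj (cyc m x) (cyc m (x + X + d))
          rw [cyc_congr m (j := x + X + d) (k := x - 1) 1 (by omega)]
          exact cyc_adj_succ m hm (Or.inr rfl)
      · refine ⟨(cyc m (x - d), cyc n y), Or.inr ?_, Or.inr
          ⟨x - d, y, X + 2 * d, 0, max 0 (l + d), max 0 (h - d), rfl, ?_, by omega, by omega,
            ?_, ?_, by omega, hD _ _ _ _ (by ring) (by omega) (by omega) (by omega) (by omega)⟩⟩
        · rw [boxProd_adj]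
          exact Or.inl ⟨cyc_adj_succ m hm (by omega), rfl⟩
        · congr 2; ring
        · simp only [abs_zero]; omega
        · simp only [abs_zero]; omega
    · have hs : ∃ s : ℤ, (s = 1 ∨ s = -1) ∧ |Y - s| = |Y| - 1 := by
        rcases lt_or_gt_of_ne hY with hY | hY
        · exact ⟨-1, Or.inr rfl, by rw [abs_of_neg hY, abs_of_nonpos (by omega)]; ring⟩
        · exact ⟨1, Or.inl rfl, by rw [abs_of_pos hY, abs_of_nonneg (by omega)]⟩
      obtain ⟨s, hs, hsY⟩ := hs
      have hYp : 0 < |Y| := abs_pos.2 hY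
      refine ⟨(cyc m x, cyc n (y + s)), Or.inr ?_, Or.inr
          ⟨x, y + s, X + d, Y - s, max 0 (l + d), max 0 (h - d), rfl, ?_, by omega, by omega,
            ?_, ?_, by omega, hD _ _ _ _ (by ring) (by omega) (by omega) (by omega) (by omega)⟩⟩
      · rw [boxProd_adj]
        exact Or.inr ⟨cyc_adj_succ n hn (by omega), rfl⟩
      · congr 2 <;> ring
      · rw [hsY]; omega
      · rw [hsY]; omega
  · have hd : ∃ d : ℤ, (d = 1 ∨ d = -1) ∧ w = cyc n (y + Y + d) := by
      rcases cyc_adj_elim n hn hr with hu | hu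
      · exact ⟨1, Or.inl rfl, hu⟩
      · exact ⟨-1, Or.inr rfl, hu⟩
    obtain ⟨d, hd, rfl⟩ := hd
    refine ⟨(cyc m x, cyc n (y + d)), Or.inr ?_, Or.inr
          ⟨x, y + d, X, Y, l, h, rfl, ?_, hl, hh, h1, h2, h3, ?_⟩⟩
    · rw [boxProd_adj]
      exact Or.inr ⟨cyc_adj_succ n hn (by omega), rfl⟩
    · congr 2; ring
    · intro v hv
      rcases hv with rfl | hv
      · exact Or.inr ⟨0, by omega, by omega, by simp⟩
      · exact h4 v hv

/-- Entering the main phase from signed coordinates. -/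
theorem Qinv_enter (m n a : ℕ) [NeZero m] [NeZero n] (ha : m = 2 * a)
    (e : Fin m × Fin n) (D : Set (Fin m × Fin n)) (x y X Y : ℤ) (h1 : |Y| < |X|)
    (h2 : |X| ≤ a) (h3 : (2 : ℤ) ∣ X + Y)
    (hD : ∀ v ∈ D, v = e ∨ v = (cyc m (x + X), cyc n (y + Y))) :
    Qinv m n e (cyc m x, cyc n y) (cyc m (x + X), cyc n (y + Y)) D := by
  rcases abs_cases X with ⟨h5, h6⟩ | ⟨h5, h6⟩
  · rw [h5] at h1 h2
    refine ⟨x, y, X, Y, 0, 0, rfl, rfl, le_rfl, le_rfl, by omega, by omega, h3, ?_⟩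
    intro v hv
    rcases hD v hv with hv | hv
    · exact Or.inl hv
    · exact Or.inr ⟨0, by simp, by simp, by simp [hv]⟩
  · rw [h5] at h1 h2
    have hc : cyc m (x + X) = cyc m (x + (X + m)) := cyc_congr m (-1) (by ring)
    refine ⟨x, y, X + m, Y, 0, 0, rfl, by rw [hc], le_rfl, le_rfl, by omega, by omega,
      by omega, ?_⟩
    intro v hv
    rcases hD v hv with hv | hv
    · exact Or.inl hv
    · exact Or.inr ⟨0, by simp, by simp, by simp [hv, hc]⟩

/-- The main phase, in either orientation. -/
def Q2 (m n : ℕ) [NeZero m] [NeZero n] (e c r : Fin m × Fin n) (D : Set (Fin m × Fin n)) : Prop :=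
  Qinv m n e c r D ∨ Qinv n m e.swap c.swap r.swap (Prod.swap ⁻¹' D)

def NextOK (m n : ℕ) [NeZero m] [NeZero n] (e c r : Fin m × Fin n)
    (D : Set (Fin m × Fin n)) : Prop :=
  ∃ c', (c' = c ∨ (cycleGraph m □ cycleGraph n).Adj c c') ∧ (c' = r ∨ Q2 m n e c' r D)

theorem adj_swap (m n : ℕ) (u v : Fin m × Fin n) :
    (cycleGraph n □ cycleGraph m).Adj u.swap v.swap ↔ (cycleGraph m □ cycleGraph n).Adj u v := by
  simp only [boxProd_adj, Prod.fst_swap, Prod.snd_swap]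
  tauto

theorem NextOK_swap (m n : ℕ) [NeZero m] [NeZero n] (e c r : Fin m × Fin n)
    (D : Set (Fin m × Fin n))
    (h : NextOK n m e.swap c.swap r.swap (Prod.swap ⁻¹' D)) : NextOK m n e c r D := by
  obtain ⟨c', h1, h2⟩ := h
  refine ⟨c'.swap, ?_, ?_⟩
  · rcases h1 with h1 | h1
    · left; rw [h1, Prod.swap_swap]
    · right; rw [← adj_swap, Prod.swap_swap]; exact h1
  · rcases h2 with h2 | h2 | h2
    · left; rw [h2, Prod.swap_swap]
    · right; right; rw [Prod.swap_swap]; exact h2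
    · right; left
      rw [← Set.preimage_comp] at h2
      simpa using h2

theorem Q2_step (m n a b : ℕ) [NeZero m] [NeZero n] (hm : 4 ≤ m) (hn : 4 ≤ n) (ha : m = 2 * a)
    (hb : n = 2 * b)
    (e c r : Fin m × Fin n) (D : Set (Fin m × Fin n)) (hQ : Q2 m n e c r D)
    (r' : Fin m × Fin n) (hr : r' = r ∨ (cycleGraph m □ cycleGraph n).Adj r r') :
    NextOK m n e c r' (insert r' D) := by
  rcases hQ with hQ | hQ
  · obtain ⟨c', h1, h2⟩ := Qinv_step m n a hm hn ha e c r D hQ r' hr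
    exact ⟨c', h1, h2.imp id Or.inl⟩
  · apply NextOK_swap
    obtain ⟨c', h1, h2⟩ := Qinv_step n m b hn hm hb e.swap c.swap r.swap _ hQ r'.swap
      (by rw [adj_swap]; exact hr.imp (fun h => by rw [h]) id)
    refine ⟨c', h1, h2.imp id (fun h => Or.inl ?_)⟩
    convert h using 1
    ext v
    simp only [Set.mem_preimage, Set.mem_insert_iff]
    rw [← Prod.swap_inj (p := v.swap), Prod.swap_swap]

theorem NextOK_of_lt (m n a b : ℕ) [NeZero m] [NeZero n] (hm : 4 ≤ m) (hn : 4 ≤ n)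
    (ha : m = 2 * a) (e : Fin m × Fin n) (D : Set (Fin m × Fin n)) (X Y : ℤ)
    (h1 : |Y| < |X|) (h2 : |X| ≤ a)
    (hD : ∀ v ∈ D, v = e ∨ v = (cyc m X, cyc n Y)) :
    NextOK m n e (cyc m 0, cyc n 0) (cyc m X, cyc n Y) D := by
  by_cases hp : (2 : ℤ) ∣ X + Y
  · refine ⟨_, Or.inl rfl, Or.inr (Or.inl ?_)⟩
    simpa using Qinv_enter m n a ha e D 0 0 X Y h1 h2 hp (by simpa using hD)
  have key : ∀ x y : ℤ, (((x = 1 ∨ x = -1) ∧ y = 0) ∨ ((y = 1 ∨ y = -1) ∧ x = 0)) →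
      |Y - y| < |X - x| → |X - x| ≤ a →
      NextOK m n e (cyc m 0, cyc n 0) (cyc m X, cyc n Y) D := by
    intro x y hxy g1 g2
    refine ⟨(cyc m x, cyc n y), Or.inr ?_, Or.inr (Or.inl ?_)⟩
    · rw [boxProd_adj]
      rcases hxy with ⟨hx, rfl⟩ | ⟨hy, rfl⟩
      · exact Or.inl ⟨cyc_adj_succ m hm (by omega), rfl⟩
      · exact Or.inr ⟨cyc_adj_succ n hn (by omega), rfl⟩
    · have := Qinv_enter m n a ha e D x y (X - x) (Y - y) g1 g2 (by omega) (by simpa using hD)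
      simpa using this
  rcases lt_trichotomy Y 0 with hY | hY | hY
  · apply key 0 (-1) (by omega) <;> simp only [abs_lt, abs_le, lt_abs, abs_of_neg hY] at * <;> grind
  · subst hY
    by_cases hX1 : X = 1 ∨ X = -1
    · refine ⟨_, Or.inr ?_, Or.inl rfl⟩
      rw [boxProd_adj]
      exact Or.inl ⟨cyc_adj_succ m hm (by omega), rfl⟩
    · rcases abs_cases X with ⟨h5, h6⟩ | ⟨h5, h6⟩
      · apply key 1 0 (by omega) <;> rw [abs_of_nonneg (a := X - 1) (by omega)] <;> simp <;> omega
      · apply key (-1) 0 (by omega) <;> rw [abs_of_neg (a := X - -1) (by omega)] <;> simp <;> omega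
  · apply key 0 1 (by omega) <;> simp only [abs_lt, abs_le, lt_abs, abs_of_pos hY] at * <;> grind

theorem NextOK_of_ne (m n a b : ℕ) [NeZero m] [NeZero n] (hm : 4 ≤ m) (hn : 4 ≤ n)
    (ha : m = 2 * a) (hb : n = 2 * b) (e : Fin m × Fin n) (D : Set (Fin m × Fin n)) (X Y : ℤ)
    (h1 : |X| ≠ |Y|) (h2 : |X| ≤ a) (h3 : |Y| ≤ b)
    (hD : ∀ v ∈ D, v = e ∨ v = (cyc m X, cyc n Y)) :
    NextOK m n e (cyc m 0, cyc n 0) (cyc m X, cyc n Y) D := by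
  rcases lt_or_gt_of_ne h1 with h | h
  · apply NextOK_swap
    apply NextOK_of_lt n m b a hn hm hb _ _ Y X h h3
    intro v hv
    rw [← Prod.swap_inj (p := v), ← Prod.swap_inj (p := v), Prod.swap_swap]
    exact hD _ hv
  · exact NextOK_of_lt m n a b hm hn ha e D X Y h h2 hD

/-- The waiting phase. -/
def P0 (m n a b : ℕ) [NeZero m] [NeZero n] (c r : Fin m × Fin n) (D : Set (Fin m × Fin n)) :
    Prop :=
  ∃ X Y : ℤ, c = (cyc m 0, cyc n 0) ∧ r = (cyc m X, cyc n Y) ∧ D = {r} ∧ |X| = |Y| ∧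
    |X| ≤ a ∧ |Y| ≤ b

theorem P0_stepx (m n a b : ℕ) [NeZero m] [NeZero n] (hm : 4 ≤ m) (hn : 4 ≤ n) (ha : m = 2 * a)
    (hb : n = 2 * b) (X Y : ℤ) (hXY : |X| = |Y|) (hX : |X| ≤ a) (hY : |Y| ≤ b) (u : Fin m)
    (hu : (cycleGraph m).Adj (cyc m X) u) (D : Set (Fin m × Fin n))
    (hD : ∀ v ∈ D, v = (cyc m X, cyc n Y) ∨ v = (u, cyc n Y)) :
    NextOK m n (cyc m X, cyc n Y) (cyc m 0, cyc n 0) (u, cyc n Y) D := by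
  have : ∃ X' : ℤ, u = cyc m X' ∧ |X'| ≠ |X| ∧ |X'| ≤ a := by
    have hX' := abs_le.1 hX
    rcases cyc_adj_elim m hm hu with hu | hu
    · by_cases hXa : X = a
      · refine ⟨X + 1 - m, by rw [hu]; exact cyc_congr m 1 (by ring), ?_, ?_⟩
        · rw [Ne, abs_eq_abs]; omega
        · rw [abs_le]; omega
      · refine ⟨X + 1, hu, ?_, ?_⟩
        · rw [Ne, abs_eq_abs]; omega
        · rw [abs_le]; omega
    · by_cases hXa : X = -a
      · refine ⟨X - 1 + m, by rw [hu]; exact cyc_congr m (-1) (by ring), ?_, ?_⟩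
        · rw [Ne, abs_eq_abs]; omega
        · rw [abs_le]; omega
      · refine ⟨X - 1, hu, ?_, ?_⟩
        · rw [Ne, abs_eq_abs]; omega
        · rw [abs_le]; omega
  obtain ⟨X', rfl, h1, h2⟩ := this
  exact NextOK_of_ne m n a b hm hn ha hb _ D X' Y (by rw [← hXY]; exact h1) h2 hY hD

theorem P0_step (m n a b : ℕ) [NeZero m] [NeZero n] (hm : 4 ≤ m) (hn : 4 ≤ n) (ha : m = 2 * a)
    (hb : n = 2 * b) (c r : Fin m × Fin n) (D : Set (Fin m × Fin n)) (hP : P0 m n a b c r D)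
    (r' : Fin m × Fin n) (hr : (cycleGraph m □ cycleGraph n).Adj r r') :
    NextOK m n r c r' (insert r' D) := by
  obtain ⟨X, Y, rfl, rfl, rfl, h1, h2, h3⟩ := hP
  obtain ⟨u, w⟩ := r'
  rw [boxProd_adj] at hr
  rcases hr with ⟨hr, rfl⟩ | ⟨hr, rfl⟩
  · apply P0_stepx m n a b hm hn ha hb X Y h1 h2 h3 u hr
    rintro v (hv | hv)
    · exact Or.inr hv
    · exact Or.inl hv
  · apply NextOK_swap
    apply P0_stepx n m b a hn hm hb ha Y X h1.symm h3 h2 w hr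
    rintro ⟨v1, v2⟩ hv
    simp only [Set.mem_preimage, Set.mem_insert_iff, Set.mem_singleton_iff, Prod.swap_prod_mk,
      Prod.mk.injEq] at hv ⊢
    tauto

theorem dmg_boxProd_cycles_even_upper {m n : ℕ} (hm : 4 ≤ m) (hn : 4 ≤ n)
    (hme : Even m) (hne : Even n) :
    dmg (cycleGraph m □ cycleGraph n) ≤
      1 + max (dmg (cycleGraph m) * n) (dmg (cycleGraph n) * m) := by
  obtain ⟨a, ha'⟩ := hme
  obtain ⟨b, hb'⟩ := hne
  have ha : m = 2 * a := by omega
  have hb : n = 2 * b := by omega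
  haveI : NeZero m := ⟨by omega⟩
  haveI : NeZero n := ⟨by omega⟩
  have hla := Nat.mul_le_mul_right n (dmg_cycle_lower m a hm ha)
  have hlb := Nat.mul_le_mul_right m (dmg_cycle_lower n b hn hb)
  apply dmg_le_of_invariant _ _
    (fun c r D => P0 m n a b c r D ∨ ∃ e, Q2 m n e c r D) (cyc m 0, cyc n 0)
  · rintro c r D (⟨X, Y, -, -, rfl, -⟩ | ⟨e, hQ | hQ⟩)
    · simp
    · have := Qinv_card m n a ha _ _ _ _ hQ
      have := le_max_left (dmg (cycleGraph m) * n) (dmg (cycleGraph n) * m)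
      omega
    · have h1 := Qinv_card n m b hb _ _ _ _ hQ
      have h2 := le_max_right (dmg (cycleGraph m) * n) (dmg (cycleGraph n) * m)
      have h3 : (Prod.swap ⁻¹' D).ncard = D.ncard := by
        rw [← Set.image_swap_eq_preimage_swap]
        exact Set.ncard_image_of_injective _ Prod.swap_injective
      omega
  · rintro ⟨u, w⟩
    obtain ⟨X, rfl, hX1, hX2⟩ := cyc_surj m a ha u
    obtain ⟨Y, rfl, hY1, hY2⟩ := cyc_surj n b hb w
    have hX := abs_le.2 ⟨hX1, hX2⟩
    have hY := abs_le.2 ⟨hY1, hY2⟩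
    by_cases h : |X| = |Y|
    · exact ⟨_, Or.inl rfl, Or.inr (Or.inl ⟨X, Y, rfl, rfl, rfl, h, hX, hY⟩)⟩
    · obtain ⟨c', h1, h2⟩ := NextOK_of_ne m n a b hm hn ha hb (cyc m X, cyc n Y)
        {(cyc m X, cyc n Y)} X Y h hX hY (fun v hv => Or.inl hv)
      exact ⟨c', h1, h2.imp id (fun h => Or.inr ⟨_, h⟩)⟩
  · rintro c r D (hP | ⟨e, hQ⟩) r' hr
    · rcases hr with rfl | hr
      · refine ⟨c, Or.inl rfl, Or.inr (Or.inl ?_)⟩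
        have hD : D = {r'} := by
          obtain ⟨_, _, _, _, h, _⟩ := hP
          exact h
        rw [Set.insert_eq_of_mem (by rw [hD]; rfl)]
        exact hP
      · obtain ⟨c', h1, h2⟩ := P0_step m n a b hm hn ha hb c r D hP r' hr
        exact ⟨c', h1, h2.imp id (fun h => Or.inr ⟨_, h⟩)⟩
    · obtain ⟨c', h1, h2⟩ := Q2_step m n a b hm hn ha hb e c r D hQ r' hr
      exact ⟨c', h1, h2.imp id (fun h => Or.inr ⟨_, h⟩)⟩
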